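/- arXiv:2602.04644 — 2 statements merged into one kernel-verified Lean document; each statement's English description precedes it below -/
import Mathlib

section
/- Let n ∈ ℕ, De > 0, let C ∈ Matrix n n ℝ be symmetric positive definite, let L ∈ Matrix n n ℝ be diagonal with strictly positive diagonal entries and satisfy C * L = L * C, and let M ∈ Matrix n n ℝ be arbitrary. Set f(q) = Φ(C, q) and define the vector field V : ℝⁿ → ℝⁿ by V(q) = f(q) · (M q) + (1/(2·De)) · L • (gradient of f at q). Then for every q ∈ ℝⁿ, the negative divergence −∑ᵢ ∂Vᵢ/∂qᵢ (q) equals (qᵀ A q − trace(A * C)) · f(q), where A = (1/2) · C⁻¹ * (M * C + C * Mᵀ − (1/De) · L) * C⁻¹. In particular, the configurational Fokker–Planck operator maps the Gaussian f into its own tangent space. -/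
open Matrix Real

/-- The quadratic form `qᵀ B q = ∑ᵢⱼ qᵢ Bᵢⱼ qⱼ` of a matrix `B`. -/
noncomputable def quadForm {n : ℕ} (B : Matrix (Fin n) (Fin n) ℝ) (q : Fin n → ℝ) : ℝ :=
  ∑ i, ∑ j, q i * B i j * q j

/-- The centered Gaussian probability density with covariance matrix `C`,
`Φ(C, q) = exp(−(1/2) qᵀ C⁻¹ q) / √((2π)ⁿ det C)`. -/
noncomputable def gaussPdf {n : ℕ} (C : Matrix (Fin n) (Fin n) ℝ) (q : Fin n → ℝ) : ℝ :=
  Real.exp (-(1 / 2) * quadForm C⁻¹ q) / Real.sqrt ((2 * Real.pi) ^ n * C.det)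

theorem quadForm_eq_dot {n : ℕ} (B : Matrix (Fin n) (Fin n) ℝ) (q : Fin n → ℝ) :
    quadForm B q = q ⬝ᵥ (B *ᵥ q) := by
  simp only [quadForm, dotProduct, mulVec, Finset.mul_sum, mul_assoc]

theorem mulVec_hasFDerivAt {n : ℕ} (B : Matrix (Fin n) (Fin n) ℝ) (q : Fin n → ℝ) (i : Fin n) :
    HasFDerivAt (fun p : Fin n → ℝ => (B *ᵥ p) i)
      (∑ j, B i j • (ContinuousLinearMap.proj j : (Fin n → ℝ) →L[ℝ] ℝ)) q := by
  simp only [mulVec, dotProduct]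
  exact HasFDerivAt.fun_sum fun j _ => (hasFDerivAt_apply j q).const_mul (B i j)

theorem quadForm_hasFDerivAt {n : ℕ} (B : Matrix (Fin n) (Fin n) ℝ) (hB : Bᵀ = B)
    (q : Fin n → ℝ) :
    HasFDerivAt (fun p : Fin n → ℝ => quadForm B p)
      (∑ i, (2 * (B *ᵥ q) i) • (ContinuousLinearMap.proj i : (Fin n → ℝ) →L[ℝ] ℝ)) q := by
  have h : HasFDerivAt (fun p : Fin n → ℝ => ∑ i, p i * (B *ᵥ p) i) _ q :=
    HasFDerivAt.fun_sum (u := Finset.univ) fun i _ =>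
      (hasFDerivAt_apply i q).mul (mulVec_hasFDerivAt B q i)
  have e : (fun p : Fin n → ℝ => quadForm B p) = fun p => ∑ i, p i * (B *ᵥ p) i := by
    funext p; rw [quadForm_eq_dot]; rfl
  rw [e]
  refine h.congr_fderiv ?_
  ext v
  have key : q ⬝ᵥ (B *ᵥ v) = v ⬝ᵥ (B *ᵥ q) := by
    rw [dotProduct_mulVec, ← mulVec_transpose, hB, dotProduct_comm]
  simp only [dotProduct] at key
  have e2 : ∀ i, ∑ j, B i j * v j = (B *ᵥ v) i := fun i => rfl
  simp only [ContinuousLinearMap.sum_apply, ContinuousLinearMap.add_apply,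
    ContinuousLinearMap.smul_apply, ContinuousLinearMap.proj_apply, smul_eq_mul,
    Finset.sum_add_distrib, e2, key]
  rw [← Finset.sum_add_distrib]
  exact Finset.sum_congr rfl fun i _ => by ring

theorem gaussPdf_hasFDerivAt {n : ℕ} (C : Matrix (Fin n) (Fin n) ℝ) (hC : C⁻¹ᵀ = C⁻¹)
    (q : Fin n → ℝ) :
    HasFDerivAt (fun p : Fin n → ℝ => gaussPdf C p)
      (∑ i, (-(gaussPdf C q * (C⁻¹ *ᵥ q) i)) •
        (ContinuousLinearMap.proj i : (Fin n → ℝ) →L[ℝ] ℝ)) q := by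
  have h := (((quadForm_hasFDerivAt C⁻¹ hC q).const_mul (-(1 / 2))).exp).mul_const
    (Real.sqrt ((2 * Real.pi) ^ n * C.det))⁻¹
  simp only [gaussPdf, div_eq_mul_inv] at h ⊢
  refine h.congr_fderiv ?_
  ext v
  simp only [ContinuousLinearMap.sum_apply,
    ContinuousLinearMap.smul_apply, ContinuousLinearMap.proj_apply, smul_eq_mul, Finset.mul_sum]
  exact Finset.sum_congr rfl fun i _ => by ring

theorem sum_smul_proj_single {n : ℕ} (w : Fin n → ℝ) (j : Fin n) :
    (∑ i, w i • (ContinuousLinearMap.proj i : (Fin n → ℝ) →L[ℝ] ℝ)) (Pi.single j 1) = w j := by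
  simp [ContinuousLinearMap.sum_apply, Pi.single_apply]

/-- The configurational Fokker–Planck operator `ℒ_q f = −div_q(M q f + (1/(2 De)) L ∇f)`
applied to the Gaussian `f = Φ(C, ·)` equals `(qᵀ A q − tr(A C)) f` with
`A = (1/2) C⁻¹ (M C + C Mᵀ − (1/De) L) C⁻¹`; in particular it lies in the tangent space of
the Gaussian manifold at `f`. -/
theorem configurational_operator_gaussPdf {n : ℕ} (De : ℝ) (hDe : 0 < De)
    (C L M : Matrix (Fin n) (Fin n) ℝ) (hC : C.PosDef)
    (hLdiag : L.IsDiag) (hLpos : ∀ i, 0 < L i i) (hcomm : C * L = L * C) :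
    ∀ q : Fin n → ℝ,
      -(∑ i, fderiv ℝ
          (fun p => gaussPdf C p * M.mulVec p i
            + (1 / (2 * De)) *
              L.mulVec (fun j => fderiv ℝ (fun r => gaussPdf C r) p (Pi.single j 1)) i)
          q (Pi.single i 1))
        = (quadForm ((1 / 2 : ℝ) • (C⁻¹ * (M * C + C * Mᵀ - (1 / De) • L) * C⁻¹)) q
            - (((1 / 2 : ℝ) • (C⁻¹ * (M * C + C * Mᵀ - (1 / De) • L) * C⁻¹)) * C).trace)
          * gaussPdf C q := by
  intro q
  have hu : IsUnit C.det := hC.det_pos.ne'.isUnit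
  have hs : Cᵀ = C := by simpa using hC.isHermitian.eq
  have hP : C⁻¹ᵀ = C⁻¹ := by rw [transpose_nonsing_inv, hs]
  set c : ℝ := 1 / (2 * De) with hc
  have hV : ∀ i, (fun p => gaussPdf C p * M.mulVec p i
            + c * L.mulVec (fun j => fderiv ℝ (fun r => gaussPdf C r) p (Pi.single j 1)) i)
      = fun p => gaussPdf C p * ((M - c • (L * C⁻¹)) *ᵥ p) i := by
    intro i
    funext p
    have e : (fun j => fderiv ℝ (fun r => gaussPdf C r) p (Pi.single j 1))
        = -(gaussPdf C p) • (C⁻¹ *ᵥ p) := by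
      funext j
      rw [(gaussPdf_hasFDerivAt C hP p).fderiv, sum_smul_proj_single]
      simp
    rw [e, mulVec_smul, mulVec_mulVec, sub_mulVec, smul_mulVec]
    simp only [Pi.smul_apply, Pi.sub_apply, smul_eq_mul]
    ring
  simp only [hV]
  set N := M - c • (L * C⁻¹) with hN
  have hD : ∀ i, fderiv ℝ (fun p => gaussPdf C p * (N *ᵥ p) i) q (Pi.single i 1)
      = gaussPdf C q * N i i - gaussPdf C q * ((C⁻¹ *ᵥ q) i * (N *ᵥ q) i) := by
    intro i
    rw [((gaussPdf_hasFDerivAt C hP q).fun_mul (mulVec_hasFDerivAt N q i)).fderiv]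
    rw [ContinuousLinearMap.add_apply, ContinuousLinearMap.smul_apply,
      ContinuousLinearMap.smul_apply, sum_smul_proj_single, sum_smul_proj_single]
    simp only [smul_eq_mul]
    ring
  simp only [hD]
  rw [Finset.sum_sub_distrib, ← Finset.mul_sum, ← Finset.mul_sum]
  have hA : C⁻¹ * (M * C + C * Mᵀ - (1 / De) • L) * C⁻¹
      = C⁻¹ * N + (C⁻¹ * N)ᵀ + c • (C⁻¹ * L * C⁻¹) + c • (C⁻¹ * Lᵀ * C⁻¹)
        - (1 / De) • (C⁻¹ * L * C⁻¹) := by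
    have h1 : C⁻¹ * (M * C) * C⁻¹ = C⁻¹ * M := by
      rw [Matrix.mul_assoc, Matrix.mul_assoc M, mul_nonsing_inv C hu, Matrix.mul_one]
    have h2 : C⁻¹ * (C * Mᵀ) * C⁻¹ = Mᵀ * C⁻¹ := by
      rw [← Matrix.mul_assoc C⁻¹, nonsing_inv_mul C hu, Matrix.one_mul]
    rw [Matrix.mul_sub, Matrix.mul_add, Matrix.sub_mul, Matrix.add_mul, h1, h2, hN]
    simp only [transpose_mul, transpose_sub, transpose_smul, hP, Matrix.mul_sub, Matrix.sub_mul,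
      Matrix.mul_smul, Matrix.smul_mul, Matrix.mul_assoc]
    abel
  have hLt : Lᵀ = L := hLdiag.isSymm
  have hA2 : (1 / 2 : ℝ) • (C⁻¹ * (M * C + C * Mᵀ - (1 / De) • L) * C⁻¹)
      = (1 / 2 : ℝ) • (C⁻¹ * N + (C⁻¹ * N)ᵀ) := by
    have h3 : c + c = 1 / De := by rw [hc]; field_simp; norm_num
    rw [hA, hLt, add_assoc (C⁻¹ * N + (C⁻¹ * N)ᵀ), ← add_smul, h3, add_sub_cancel_right]
  rw [hA2]
  have hq : quadForm ((1 / 2 : ℝ) • (C⁻¹ * N + (C⁻¹ * N)ᵀ)) q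
      = ∑ i, (C⁻¹ *ᵥ q) i * (N *ᵥ q) i := by
    have t : q ⬝ᵥ ((C⁻¹ * N)ᵀ *ᵥ q) = q ⬝ᵥ ((C⁻¹ * N) *ᵥ q) := by
      rw [mulVec_transpose, dotProduct_comm, ← dotProduct_mulVec]
    have t2 : q ⬝ᵥ ((C⁻¹ * N) *ᵥ q) = (C⁻¹ *ᵥ q) ⬝ᵥ (N *ᵥ q) := by
      rw [← mulVec_mulVec, dotProduct_mulVec, ← mulVec_transpose, hP]
    rw [quadForm_eq_dot, smul_mulVec, add_mulVec, dotProduct_smul, dotProduct_add, t, t2,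
      smul_eq_mul]
    simp only [dotProduct]
    ring
  have ht : (((1 / 2 : ℝ) • (C⁻¹ * N + (C⁻¹ * N)ᵀ)) * C).trace = ∑ i, N i i := by
    have t1 : (C⁻¹ * N * C).trace = N.trace := by
      rw [trace_mul_comm, ← Matrix.mul_assoc, mul_nonsing_inv C hu, Matrix.one_mul]
    have t2 : ((C⁻¹ * N)ᵀ * C).trace = N.trace := by
      rw [transpose_mul, hP, Matrix.mul_assoc, nonsing_inv_mul C hu, Matrix.mul_one,
        trace_transpose]
    rw [Matrix.smul_mul, trace_smul, Matrix.add_mul, trace_add, t1, t2, smul_eq_mul]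
    simp only [trace, diag_apply]
    ring
  rw [hq, ht]
  ring
end

section
/- Let n, d ∈ ℕ, let C ∈ Matrix n n ℝ be symmetric positive definite, and let D₁, …, D_d ∈ Matrix n n ℝ be symmetric. Define ρ : ℝⁿ → ℝ by ρ(q) = ∑ᵢ [ qᵀ (C⁻¹ Dᵢ)² C⁻¹ q − (1/2)·trace((C⁻¹ Dᵢ)²) − (1/4)·( qᵀ C⁻¹ Dᵢ C⁻¹ q − trace(C⁻¹ Dᵢ) )² ]. Then for every symmetric matrix A ∈ Matrix n n ℝ, ∫_{ℝⁿ} ρ(q) · (qᵀ A q − trace(A * C)) · Φ(C, q) dq = 0. In particular, the remainder ρ·Φ(C,·) of the spatial operator is orthogonal to the tangent space of the Gaussian manifold at Φ(C,·) with respect to the inner product weighted by 1/Φ(C,·). -/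
open Matrix Real MeasureTheory

/-- The spatial remainder `ρ` built from `C` and the symmetric matrices `Dᵢ`:
`ρ(q) = ∑ᵢ [ qᵀ (C⁻¹Dᵢ)² C⁻¹ q − (1/2) tr((C⁻¹Dᵢ)²) − (1/4)(qᵀ C⁻¹Dᵢ C⁻¹ q − tr(C⁻¹Dᵢ))² ]`. -/
noncomputable def rhoRem {n d : ℕ} (C : Matrix (Fin n) (Fin n) ℝ)
    (D : Fin d → Matrix (Fin n) (Fin n) ℝ) (q : Fin n → ℝ) : ℝ :=
  ∑ i, (quadForm (C⁻¹ * D i * C⁻¹ * D i * C⁻¹) q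
    - (1 / 2) * ((C⁻¹ * D i) * (C⁻¹ * D i)).trace
    - (1 / 4) * (quadForm (C⁻¹ * D i * C⁻¹) q - (C⁻¹ * D i).trace) ^ 2)



noncomputable def wt (x : ℝ) : ℝ := Real.exp (-(1/2) * x ^ 2) / Real.sqrt (2 * Real.pi)

lemma wt_int_pow (k : ℕ) : Integrable (fun x : ℝ => x ^ k * wt x) := by
  have h := integrable_rpow_mul_exp_neg_mul_sq (b := 1/2) (by norm_num) (s := k)
    (by have : (0:ℝ) ≤ k := Nat.cast_nonneg k
        linarith)
  have h2 := h.div_const (Real.sqrt (2 * Real.pi))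
  refine h2.congr (Filter.Eventually.of_forall fun x => ?_)
  simp only [wt, Real.rpow_natCast]
  ring

lemma wt_int_poly (P : Polynomial ℝ) : Integrable (fun x : ℝ => P.eval x * wt x) := by
  induction P using Polynomial.induction_on' with
  | add p q hp hq =>
    simp only [Polynomial.eval_add, add_mul]
    exact hp.add hq
  | monomial k a =>
    simpa [Polynomial.eval_monomial, mul_assoc] using (wt_int_pow k).const_mul a

/-- One-dimensional Gaussian expectation on polynomials. -/
noncomputable def eg : Polynomial ℝ →ₗ[ℝ] ℝ where
  toFun P := ∫ x : ℝ, P.eval x * wt x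
  map_add' p q := by
    simp only [Polynomial.eval_add, add_mul]
    exact integral_add (wt_int_poly p) (wt_int_poly q)
  map_smul' a p := by
    simp only [Polynomial.eval_smul, smul_eq_mul, mul_assoc, RingHom.id_apply]
    exact integral_const_mul _ _

lemma eg_one : eg 1 = 1 := by
  change ∫ x : ℝ, (1 : Polynomial ℝ).eval x * wt x = 1
  simp only [Polynomial.eval_one, one_mul, wt]
  rw [integral_div, integral_gaussian]
  have : Real.pi / (1/2) = 2 * Real.pi := by ring
  rw [this]
  exact div_self (by positivity)

lemma wt_deriv (x : ℝ) : HasDerivAt (fun x => - wt x) (x * wt x) x := by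
  unfold wt
  have h : HasDerivAt (fun x : ℝ => -(1/2) * x ^ 2) (-x) x := by
    have := (hasDerivAt_pow 2 x).const_mul (-(1/2 : ℝ))
    refine this.congr_deriv ?_
    simp
  have := (h.exp.div_const (Real.sqrt (2 * Real.pi))).neg
  refine this.congr_deriv ?_
  ring

/-- Stein's identity in dimension one. -/
lemma eg_stein (P : Polynomial ℝ) : eg (Polynomial.X * P) = eg P.derivative := by
  change ∫ x : ℝ, (Polynomial.X * P).eval x * wt x = ∫ x : ℝ, P.derivative.eval x * wt x
  have := integral_mul_deriv_eq_deriv_mul_of_integrable (u := fun x => P.eval x)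
    (u' := fun x => P.derivative.eval x) (v := fun x => - wt x) (v' := fun x => x * wt x)
    (fun x _ => P.hasDerivAt x) (fun x _ => wt_deriv x) ?_ ?_ ?_
  · simp only [mul_neg, integral_neg, neg_neg] at this
    rw [← this]
    congr 1
    ext x
    simp
    ring
  · refine (wt_int_poly (Polynomial.X * P)).congr (Filter.Eventually.of_forall fun x => ?_)
    simp
    ring
  · refine (wt_int_poly (P.derivative)).neg.congr (Filter.Eventually.of_forall fun x => ?_)
    simp
  · refine (wt_int_poly P).neg.congr (Filter.Eventually.of_forall fun x => ?_)
    simp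

lemma eg_X : eg Polynomial.X = 0 := by
  have := eg_stein 1
  simpa using this

lemma eg_X_pow (k : ℕ) : eg (Polynomial.X ^ (k + 2)) = (k + 1) * eg (Polynomial.X ^ k) := by
  have := eg_stein (Polynomial.X ^ (k+1))
  rw [← pow_succ'] at this
  rw [this, Polynomial.derivative_X_pow, ← Polynomial.smul_eq_C_mul, map_smul]
  simp

lemma eg_X2 : eg (Polynomial.X ^ 2) = 1 := by
  have := eg_X_pow 0
  simpa [eg_one] using this

lemma eg_X3 : eg (Polynomial.X ^ 3) = 0 := by
  have := eg_X_pow 1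
  simpa [eg_X] using this

lemma eg_X4 : eg (Polynomial.X ^ 4) = 3 := by
  have := eg_X_pow 2
  simp only [eg_X2] at this
  rw [this]; norm_num

lemma eg_X5 : eg (Polynomial.X ^ 5) = 0 := by
  have := eg_X_pow 3
  simp only [eg_X3] at this
  rw [this]; norm_num

lemma eg_X6 : eg (Polynomial.X ^ 6) = 15 := by
  have := eg_X_pow 4
  simp only [eg_X4] at this
  rw [this]; norm_num

/-- Second Hermite polynomial. -/
noncomputable def Hp : Polynomial ℝ := Polynomial.X ^ 2 - 1

lemma eg_H : eg Hp = 0 := by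
  simp [Hp, eg_X2, eg_one]

lemma eg_HH : eg (Hp * Hp) = 2 := by
  have : Hp * Hp = Polynomial.X ^ 4 - (2:ℝ) • Polynomial.X ^ 2 + 1 := by
    rw [Hp, Polynomial.smul_eq_C_mul, map_ofNat]; ring
  rw [this]
  simp [eg_X2, eg_X4, eg_one]; norm_num

lemma eg_HHH : eg (Hp * Hp * Hp) = 8 := by
  have : Hp * Hp * Hp = Polynomial.X ^ 6 - (3:ℝ) • Polynomial.X ^ 4
      + (3:ℝ) • Polynomial.X ^ 2 - 1 := by
    rw [Hp, Polynomial.smul_eq_C_mul, Polynomial.smul_eq_C_mul, map_ofNat]; ring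
  rw [this]
  simp [eg_X2, eg_X4, eg_X6, eg_one]; norm_num

lemma eg_HX : eg (Hp * Polynomial.X) = 0 := by
  have : Hp * Polynomial.X = Polynomial.X ^ 3 - Polynomial.X := by
    rw [Hp]; ring
  rw [this]
  simp [eg_X, eg_X3]

lemma eg_HHX : eg (Hp * Hp * Polynomial.X) = 0 := by
  have : Hp * Hp * Polynomial.X = Polynomial.X ^ 5 - (2:ℝ) • Polynomial.X ^ 3
      + Polynomial.X := by
    rw [Hp, Polynomial.smul_eq_C_mul, map_ofNat]; ring
  rw [this]
  simp [eg_X, eg_X3, eg_X5]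

/-- Standard Gaussian weight in dimension `n`. -/
noncomputable def Wt {n : ℕ} (x : Fin n → ℝ) : ℝ := ∏ m, wt (x m)

/-- `f` has Gaussian expectation `v`. -/
def HE {n : ℕ} (f : (Fin n → ℝ) → ℝ) (v : ℝ) : Prop :=
  Integrable (fun x => f x * Wt x) ∧ ∫ x, f x * Wt x = v

lemma HE.add {n : ℕ} {f g : (Fin n → ℝ) → ℝ} {u v : ℝ} (hf : HE f u) (hg : HE g v) :
    HE (fun x => f x + g x) (u + v) := by
  unfold HE
  simp only [add_mul]
  exact ⟨hf.1.add hg.1, by rw [integral_add hf.1 hg.1, hf.2, hg.2]⟩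

lemma HE.smul {n : ℕ} {f : (Fin n → ℝ) → ℝ} {u : ℝ} (c : ℝ) (hf : HE f u) :
    HE (fun x => c * f x) (c * u) := by
  unfold HE
  simp only [mul_assoc]
  exact ⟨hf.1.const_mul c, by rw [integral_const_mul, hf.2]⟩

lemma HE.sum {n : ℕ} {ι : Type*} (s : Finset ι) {f : ι → (Fin n → ℝ) → ℝ} {u : ι → ℝ}
    (hf : ∀ i ∈ s, HE (f i) (u i)) :
    HE (fun x => ∑ i ∈ s, f i x) (∑ i ∈ s, u i) := by
  unfold HE
  simp only [Finset.sum_mul]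
  refine ⟨integrable_finsetSum _ fun i hi => (hf i hi).1, ?_⟩
  rw [integral_finsetSum _ fun i hi => (hf i hi).1]
  exact Finset.sum_congr rfl fun i hi => (hf i hi).2

lemma HE.prod {n : ℕ} (P : Fin n → Polynomial ℝ) :
    HE (fun x => ∏ m, (P m).eval (x m)) (∏ m, eg (P m)) := by
  unfold HE Wt
  simp only [← Finset.prod_mul_distrib]
  refine ⟨?_, ?_⟩
  · exact Integrable.fintype_prod (f := fun m (y : ℝ) => (P m).eval y * wt y)
      fun m => wt_int_poly (P m)
  · exact integral_fintype_prod_volume_eq_prod (fun m (y : ℝ) => (P m).eval y * wt y)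

/-- Factor at coordinate `m` of `p(x_k)`. -/
noncomputable def fac {n : ℕ} (k : Fin n) (p : Polynomial ℝ) (m : Fin n) : Polynomial ℝ :=
  if m = k then p else 1

lemma prod_fac {n : ℕ} (k : Fin n) (p : Polynomial ℝ) (x : Fin n → ℝ) :
    ∏ m, (fac k p m).eval (x m) = p.eval (x k) := by
  unfold fac
  rw [Finset.prod_eq_single k]
  · simp
  · intro b _ hb
    simp [hb]
  · simp

lemma HE.single {n : ℕ} (k : Fin n) (p : Polynomial ℝ) :
    HE (fun x : Fin n → ℝ => p.eval (x k)) (eg p) := by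
  have := HE.prod (fac k p)
  simp only [prod_fac] at this
  convert this using 1
  unfold fac
  rw [Finset.prod_eq_single k]
  · simp
  · intro b _ hb
    simp [hb, eg_one]
  · simp

lemma HE.four {n : ℕ} (k l i j : Fin n) (p q r s : Polynomial ℝ) (m : Fin n)
    (hm : eg (fac k p m * fac l q m * fac i r m * fac j s m) = 0) :
    HE (fun x : Fin n → ℝ => p.eval (x k) * q.eval (x l) * r.eval (x i) * s.eval (x j)) 0 := by
  have := HE.prod (fun m => fac k p m * fac l q m * fac i r m * fac j s m)
  simp only [Polynomial.eval_mul, Finset.prod_mul_distrib, prod_fac] at this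
  rwa [Finset.prod_eq_zero (Finset.mem_univ m) hm] at this

/-- The elementary tangent functions. -/
noncomputable def Qf {n : ℕ} (i j : Fin n) (x : Fin n → ℝ) : ℝ :=
  x i * x j - if i = j then 1 else 0

lemma Qf_self {n : ℕ} (i : Fin n) (x : Fin n → ℝ) : Qf i i x = Hp.eval (x i) := by
  simp [Qf, Hp]; ring

lemma HE_Q {n : ℕ} (i j : Fin n) : HE (fun x => Qf i j x) 0 := by
  by_cases h : i = j
  · subst h
    simp only [Qf_self]
    have := HE.single i Hp
    rwa [eg_H] at this
  · have := HE.four i i i j 1 1 Polynomial.X Polynomial.X i (by simp [fac, h, eg_X])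
    simpa [Qf, h] using this

lemma HE_HQ {n : ℕ} (k i j : Fin n) :
    HE (fun x => Hp.eval (x k) * Qf i j x) (if i = k ∧ j = k then 2 else 0) := by
  by_cases h : i = j
  · subst h
    simp only [Qf_self]
    by_cases hk : i = k
    · subst hk
      have := HE.single i (Hp * Hp)
      simpa [eg_HH] using this
    · have := HE.four k i i i Hp Hp 1 1 i (by simp [fac, hk, eg_H])
      simpa [hk] using this
  · have := HE.four k i i j Hp 1 Polynomial.X Polynomial.X i (by
      by_cases hk : i = k
      · subst hk; simp [fac, h, eg_HX]
      · simp [fac, h, hk, eg_X])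
    have h2 : ¬ (i = k ∧ j = k) := fun hh => h (hh.1.trans hh.2.symm)
    simpa [Qf, h, h2, mul_assoc] using this

lemma HE_HHQ {n : ℕ} (k l i j : Fin n) :
    HE (fun x => Hp.eval (x k) * Hp.eval (x l) * Qf i j x)
      (if k = l ∧ i = k ∧ j = k then 8 else 0) := by
  by_cases h : i = j
  · subst h
    simp only [Qf_self]
    by_cases hkl : k = l
    · subst hkl
      by_cases hk : i = k
      · subst hk
        have := HE.single i (Hp * Hp * Hp)
        simpa [eg_HHH] using this
      · have := HE.four k k i i Hp Hp Hp 1 i (by simp [fac, hk, eg_H])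
        simpa [hk] using this
    · have := HE.four k l i i Hp Hp Hp 1 (if i = k then l else k) (by
        by_cases hk : i = k
        · subst hk; simp [fac, Ne.symm hkl, eg_H]
        · simp [fac, hk, Ne.symm hk, hkl, eg_H])
      simpa [hkl] using this
  · have := HE.four k l i j Hp Hp Polynomial.X Polynomial.X i (by
      by_cases hk : i = k <;> by_cases hl : i = l <;>
        simp [fac, h, hk, hl, eg_HX, eg_X, eg_HHX] <;> simp_all [eg_HX, eg_X, eg_HHX])
    have h2 : ¬ (k = l ∧ i = k ∧ j = k) := fun hh => h (hh.2.1.trans hh.2.2.symm)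
    simpa [Qf, h, h2, mul_assoc] using this

/-- The diagonal case. -/
lemma HE_diag {n : ℕ} (b : Fin n → ℝ) (A : Matrix (Fin n) (Fin n) ℝ) :
    HE (fun x : Fin n → ℝ => ((∑ k, b k ^ 2 * x k ^ 2) - (1/2) * (∑ k, b k ^ 2)
      - (1/4) * ((∑ k, b k * x k ^ 2) - ∑ k, b k) ^ 2) * (quadForm A x - A.trace)) 0 := by
  have hA : ∀ x, quadForm A x - A.trace = ∑ i, ∑ j, A i j * Qf i j x := by
    intro x
    simp only [quadForm, Qf, Matrix.trace, Matrix.diag, mul_sub, Finset.sum_sub_distrib]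
    simp
    exact Finset.sum_congr rfl fun i _ => Finset.sum_congr rfl fun j _ => by ring
  have hB : ∀ x : Fin n → ℝ, ((∑ k, b k ^ 2 * x k ^ 2) - (1/2) * (∑ k, b k ^ 2)
      - (1/4) * ((∑ k, b k * x k ^ 2) - ∑ k, b k) ^ 2)
      = (∑ k, b k ^ 2 * Hp.eval (x k)) + (1/2) * (∑ k, b k ^ 2)
        + (-(1/4)) * ∑ k, ∑ l, (b k * b l) * (Hp.eval (x k) * Hp.eval (x l)) := by
    intro x
    have h1 : (∑ k, b k * x k ^ 2) - ∑ k, b k = ∑ k, b k * Hp.eval (x k) := by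
      simp [Hp, mul_sub]
    have h2 : (∑ k, b k ^ 2 * x k ^ 2) = (∑ k, b k ^ 2 * Hp.eval (x k)) + ∑ k, b k ^ 2 := by
      simp [Hp, mul_sub]
    rw [h1, h2, sq (∑ k, b k * Hp.eval (x k)), Finset.sum_mul_sum]
    have h3 : ∀ k l, b k * Hp.eval (x k) * (b l * Hp.eval (x l))
      = (b k * b l) * (Hp.eval (x k) * Hp.eval (x l)) := fun k l => by ring
    simp only [h3]
    ring
  have key : ∀ i j, HE (fun x : Fin n → ℝ => A i j * ((∑ k, b k ^ 2 * (Hp.eval (x k) * Qf i j x))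
      + (1/2) * (∑ k, b k ^ 2) * Qf i j x
      + (-(1/4)) * ∑ k, ∑ l, (b k * b l) * (Hp.eval (x k) * Hp.eval (x l) * Qf i j x))) 0 := by
    intro i j
    have h := ((((HE.sum Finset.univ fun k _ => (HE_HQ k i j).smul (b k ^ 2)).add
      ((HE_Q i j).smul ((1/2) * (∑ k, b k ^ 2)))).add
      ((HE.sum Finset.univ fun k _ => HE.sum Finset.univ fun l _ =>
        (HE_HHQ k l i j).smul (b k * b l)).smul (-(1/4)))).smul (A i j))
    convert h using 1
    simp only [ite_and]
    by_cases hij : i = j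
    · subst hij
      simp
      right
      ring
    · have : ∀ k, (if i = k then if j = k then (2:ℝ) else 0 else 0) = 0 := by
        intro k; split_ifs <;> simp_all
      have h8 : ∀ k, (if i = k then if j = k then (8:ℝ) else 0 else 0) = 0 := by
        intro k; split_ifs <;> simp_all
      simp [this, h8]
  have := HE.sum Finset.univ fun i _ => HE.sum Finset.univ fun j _ => key i j
  simp only [Finset.sum_const_zero] at this
  convert this using 2 with x
  rw [hA, hB, Finset.mul_sum]
  refine Finset.sum_congr rfl fun i _ => ?_
  rw [Finset.mul_sum]
  refine Finset.sum_congr rfl fun j _ => ?_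
  simp only [← mul_assoc, ← Finset.sum_mul]
  ring

lemma quadForm_eq {n : ℕ} (M : Matrix (Fin n) (Fin n) ℝ) (q : Fin n → ℝ) :
    quadForm M q = q ⬝ᵥ (M *ᵥ q) := by
  simp only [quadForm, dotProduct, Matrix.mulVec, Finset.mul_sum, mul_assoc]

lemma quadForm_comp {n : ℕ} (M S : Matrix (Fin n) (Fin n) ℝ) (x : Fin n → ℝ) :
    quadForm M (S *ᵥ x) = quadForm (Sᵀ * M * S) x := by
  rw [quadForm_eq, quadForm_eq, ← Matrix.mulVec_mulVec, ← Matrix.mulVec_mulVec,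
    Matrix.dotProduct_mulVec x, Matrix.vecMul_transpose]

lemma quadForm_diagonal {n : ℕ} (b : Fin n → ℝ) (x : Fin n → ℝ) :
    quadForm (Matrix.diagonal b) x = ∑ k, b k * x k ^ 2 := by
  rw [quadForm_eq]
  simp only [Matrix.mulVec_diagonal, dotProduct]
  exact Finset.sum_congr rfl fun i _ => by ring

open scoped MatrixOrder in
lemma exists_S {n : ℕ} (C : Matrix (Fin n) (Fin n) ℝ) (hC : C.PosDef)
    (D : Matrix (Fin n) (Fin n) ℝ) (hD : D.IsSymm) :
    ∃ (S : Matrix (Fin n) (Fin n) ℝ) (b : Fin n → ℝ), S * Sᵀ = C ∧ S.det ≠ 0 ∧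
      Sᵀ * (C⁻¹ * D * C⁻¹) * S = Matrix.diagonal b := by
  obtain ⟨B, hB⟩ : ∃ B : Matrix (Fin n) (Fin n) ℝ, C = Bᵀ * B := by
    obtain ⟨B, hB⟩ := (CStarAlgebra.nonneg_iff_eq_star_mul_self).1 hC.posSemidef.nonneg
    exact ⟨B, by simpa [Matrix.star_eq_conjTranspose] using hB⟩
  have hCs : Cᵀ = C := by simpa [Matrix.IsHermitian] using hC.isHermitian
  set P := B * (C⁻¹ * D * C⁻¹) * Bᵀ with hP
  have hPs : P.IsHermitian := by
    simp only [Matrix.IsHermitian, Matrix.conjTranspose_eq_transpose_of_trivial, hP,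
      Matrix.transpose_mul, Matrix.transpose_transpose, Matrix.transpose_nonsing_inv, hCs, hD.eq,
      Matrix.mul_assoc]
  set U : Matrix (Fin n) (Fin n) ℝ := (hPs.eigenvectorUnitary).1 with hU
  have hU1 : U * Uᵀ = 1 := by
    have := Unitary.coe_mul_star_self hPs.eigenvectorUnitary
    simpa [Matrix.star_eq_conjTranspose] using this
  have hU2 : Uᵀ * U = 1 := by
    have := Unitary.coe_star_mul_self hPs.eigenvectorUnitary
    simpa [Matrix.star_eq_conjTranspose] using this
  have hspec : P = U * Matrix.diagonal hPs.eigenvalues * Uᵀ := by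
    have := hPs.spectral_theorem
    rw [Unitary.conjStarAlgAut_apply] at this
    simpa [Matrix.star_eq_conjTranspose] using this
  have hSS : (Bᵀ * U) * (Bᵀ * U)ᵀ = C := by
    rw [Matrix.transpose_mul, Matrix.transpose_transpose, Matrix.mul_assoc, ← Matrix.mul_assoc U,
      hU1, Matrix.one_mul, hB]
  refine ⟨Bᵀ * U, hPs.eigenvalues, hSS, ?_, ?_⟩
  · intro h0
    have := hC.det_pos
    rw [← hSS, Matrix.det_mul, h0] at this
    simp at this
  · have : (Bᵀ * U)ᵀ * (C⁻¹ * D * C⁻¹) * (Bᵀ * U) = Uᵀ * P * U := by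
      rw [hP, Matrix.transpose_mul, Matrix.transpose_transpose]
      simp only [Matrix.mul_assoc]
    rw [this]
    clear_value U
    generalize hPs.eigenvalues = ev at hspec ⊢
    rw [hspec]
    calc Uᵀ * (U * Matrix.diagonal ev * Uᵀ) * U
        = (Uᵀ * U) * Matrix.diagonal ev * (Uᵀ * U) := by
          simp only [Matrix.mul_assoc]
      _ = _ := by rw [hU2, Matrix.one_mul, Matrix.mul_one]

lemma change_var {n : ℕ} (S : Matrix (Fin n) (Fin n) ℝ) (hS : S.det ≠ 0)
    (F : (Fin n → ℝ) → ℝ) (h1 : Integrable (fun x => F (S *ᵥ x)))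
    (h2 : ∫ x, F (S *ᵥ x) = 0) : Integrable F ∧ ∫ q, F q = 0 := by
  have hm := Real.map_matrix_volume_pi_eq_smul_volume_pi hS
  have hinj : Function.Injective (Matrix.toLin' S) := by
    have : IsUnit S := (Matrix.isUnit_iff_isUnit_det S).2 (isUnit_iff_ne_zero.2 hS)
    exact Matrix.mulVec_injective_of_isUnit this
  have hemb : MeasurableEmbedding (Matrix.toLin' S) :=
    (LinearMap.isClosedEmbedding_of_injective (LinearMap.ker_eq_bot.2 hinj)).measurableEmbedding
  have hc0 : ENNReal.ofReal |S.det⁻¹| ≠ 0 := by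
    simpa using hS
  have hi : Integrable F (Measure.map (Matrix.toLin' S) volume) := by
    rw [hemb.integrable_map_iff]
    exact h1
  have he : ∫ q, F q ∂(Measure.map (Matrix.toLin' S) volume) = 0 := by
    rw [hemb.integral_map]
    exact h2
  rw [hm] at hi he
  refine ⟨(integrable_smul_measure hc0 ENNReal.ofReal_ne_top).1 hi, ?_⟩
  rw [integral_smul_measure, ENNReal.toReal_ofReal (abs_nonneg _), smul_eq_mul] at he
  exact (mul_eq_zero.1 he).resolve_left (by simpa using hS)

lemma one_term {n : ℕ} (C : Matrix (Fin n) (Fin n) ℝ) (hC : C.PosDef)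
    (D : Matrix (Fin n) (Fin n) ℝ) (hD : D.IsSymm) (A : Matrix (Fin n) (Fin n) ℝ) :
    Integrable (fun q : Fin n → ℝ => (quadForm (C⁻¹ * D * C⁻¹ * D * C⁻¹) q
    - (1 / 2) * ((C⁻¹ * D) * (C⁻¹ * D)).trace
    - (1 / 4) * (quadForm (C⁻¹ * D * C⁻¹) q - (C⁻¹ * D).trace) ^ 2)
      * (quadForm A q - (A * C).trace) * gaussPdf C q) ∧
    ∫ q : Fin n → ℝ, (quadForm (C⁻¹ * D * C⁻¹ * D * C⁻¹) q
    - (1 / 2) * ((C⁻¹ * D) * (C⁻¹ * D)).trace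
    - (1 / 4) * (quadForm (C⁻¹ * D * C⁻¹) q - (C⁻¹ * D).trace) ^ 2)
      * (quadForm A q - (A * C).trace) * gaussPdf C q = 0 := by
  obtain ⟨S, b, hSC, hS, hb⟩ := exists_S C hC D hD
  have hSu : IsUnit S.det := isUnit_iff_ne_zero.2 hS
  have hCu : IsUnit C.det := isUnit_iff_ne_zero.2 hC.det_pos.ne'
  have hSTu : IsUnit Sᵀ.det := by rwa [Matrix.det_transpose]
  have hCi : C⁻¹ * C = 1 := Matrix.nonsing_inv_mul C hCu
  have e1 : Sᵀ * C⁻¹ * S = Matrix.diagonal (fun _ => (1:ℝ)) := by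
    rw [← hSC, Matrix.mul_inv_rev, ← Matrix.mul_assoc, Matrix.mul_nonsing_inv _ hSTu,
      Matrix.one_mul, Matrix.nonsing_inv_mul _ hSu, Matrix.diagonal_one]
  set K := C⁻¹ * D * C⁻¹ with hK
  have hKK : C⁻¹ * D * C⁻¹ * D * C⁻¹ = K * S * (Sᵀ * K) := by
    calc _ = K * (D * C⁻¹) := by simp only [hK, Matrix.mul_assoc]
      _ = K * (C * C⁻¹) * (D * C⁻¹) := by
        rw [Matrix.mul_nonsing_inv C hCu, Matrix.mul_one]
      _ = K * (S * Sᵀ) * (C⁻¹ * D * C⁻¹) := by rw [hSC]; simp only [Matrix.mul_assoc]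
      _ = _ := by rw [← hK]; simp only [Matrix.mul_assoc]
  have hCD : C⁻¹ * D = K * S * Sᵀ := by
    rw [Matrix.mul_assoc K, hSC, hK, Matrix.mul_assoc _ C⁻¹, hCi, Matrix.mul_one]
  have e2 : Sᵀ * (C⁻¹ * D * C⁻¹ * D * C⁻¹) * S = Matrix.diagonal (fun k => b k ^ 2) := by
    rw [hKK]
    calc _ = (Sᵀ * K * S) * (Sᵀ * K * S) := by simp only [Matrix.mul_assoc]
      _ = _ := by
        rw [hb, Matrix.diagonal_mul_diagonal]
        simp only [sq]
  have t1 : (C⁻¹ * D).trace = ∑ k, b k := by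
    rw [hCD, Matrix.trace_mul_comm, ← Matrix.mul_assoc, hb, Matrix.trace_diagonal]
  have t2 : ((C⁻¹ * D) * (C⁻¹ * D)).trace = ∑ k, b k ^ 2 := by
    rw [hCD, ← Matrix.mul_assoc, Matrix.trace_mul_comm]
    have : Sᵀ * (K * S * Sᵀ * (K * S)) = (Sᵀ * K * S) * (Sᵀ * K * S) := by
      simp only [Matrix.mul_assoc]
    rw [this, hb, Matrix.diagonal_mul_diagonal, Matrix.trace_diagonal]
    simp only [sq]
  have t3 : (A * C).trace = (Sᵀ * A * S).trace := by
    rw [← hSC, ← Matrix.mul_assoc, Matrix.trace_mul_comm, Matrix.mul_assoc]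
  have hgauss : ∀ x : Fin n → ℝ, gaussPdf C (S *ᵥ x) =
      (Real.sqrt (2 * Real.pi) ^ n / Real.sqrt ((2 * Real.pi) ^ n * C.det)) * Wt x := by
    intro x
    have hp : (Real.sqrt (2 * Real.pi) ^ n) ≠ 0 := by positivity
    unfold gaussPdf Wt wt
    rw [quadForm_comp, e1, quadForm_diagonal, Finset.prod_div_distrib, ← Real.exp_sum,
      Finset.prod_const, Finset.card_univ, Fintype.card_fin, Finset.mul_sum]
    simp only [one_mul]
    field_simp
  rw [← hK] at e2
  have hmain := (HE_diag b (Sᵀ * A * S)).smul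
    (Real.sqrt (2 * Real.pi) ^ n / Real.sqrt ((2 * Real.pi) ^ n * C.det))
  rw [mul_zero] at hmain
  apply change_var S hS
  · refine hmain.1.congr (Filter.Eventually.of_forall fun x => ?_)
    simp only [hgauss, quadForm_comp, e2, hb, t1, t2, t3, quadForm_diagonal]
    ring
  · rw [← hmain.2]
    congr 1
    ext x
    simp only [hgauss, quadForm_comp, e2, hb, t1, t2, t3, quadForm_diagonal]
    ring

/-- The remainder `ρ · Φ(C, ·)` of the spatial operator is orthogonal to the tangent space of
the Gaussian manifold at `Φ(C, ·)` with respect to the inner product weighted by `1/Φ(C, ·)`: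
for every symmetric `A`, `∫ ρ(q)(qᵀ A q − tr(A C)) Φ(C, q) dq = 0`. -/
theorem rho_orthogonal_tangent {n d : ℕ} (C : Matrix (Fin n) (Fin n) ℝ) (hC : C.PosDef)
    (D : Fin d → Matrix (Fin n) (Fin n) ℝ) (hD : ∀ i, (D i).IsSymm) :
    ∀ A : Matrix (Fin n) (Fin n) ℝ, A.IsSymm →
      ∫ q : Fin n → ℝ,
        rhoRem C D q * (quadForm A q - (A * C).trace) * gaussPdf C q = 0 := by

  intro A _
  have h := fun i => one_term C hC (D i) (hD i) A
  simp only [rhoRem, Finset.sum_mul]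
  rw [integral_finsetSum _ fun i _ => (h i).1]
  exact Finset.sum_eq_zero fun i _ => (h i).2
end
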